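/- Let u be a smooth positive solution of Δu + u^p = 0 in ℝⁿ, n > 2, with 1 < p < (n+2)/(n-2). Then no such u exists; equivalently the only nonnegative solution with f(u)=u^p is u ≡ 0. -/

import Mathlib

/-- The Euclidean Laplacian of `u : ℝⁿ → ℝ`, as the trace of the second derivative. -/
noncomputable def euclideanLaplacian {n : ℕ} (u : EuclideanSpace ℝ (Fin n) → ℝ)
    (x : EuclideanSpace ℝ (Fin n)) : ℝ :=
  ∑ i, iteratedFDeriv ℝ 2 u x ![EuclideanSpace.single i 1, EuclideanSpace.single i 1]

open MeasureTheory Metric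
open scoped ContDiff

namespace GS

/-- partial derivative -/
noncomputable def D {n : ℕ} (i : Fin n) (f : EuclideanSpace ℝ (Fin n) → ℝ)
    (x : EuclideanSpace ℝ (Fin n)) : ℝ :=
  fderiv ℝ f x (EuclideanSpace.single i 1)

variable {n : ℕ} {f g u : EuclideanSpace ℝ (Fin n) → ℝ}

lemma D_smooth (hf : ContDiff ℝ ∞ f) (i : Fin n) : ContDiff ℝ ∞ (D i f) := by
  unfold D
  exact (hf.fderiv_right (m := ∞) (by simp)).clm_apply contDiff_const

lemma diff (hf : ContDiff ℝ ∞ f) (x) : DifferentiableAt ℝ f x :=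
  (hf.differentiable (by simp)) x

lemma D_mul (hf : ContDiff ℝ ∞ f) (hg : ContDiff ℝ ∞ g) (i : Fin n) :
    D i (fun x => f x * g x) = fun x => D i f x * g x + f x * D i g x := by
  funext x
  unfold D
  rw [fderiv_fun_mul (diff hf x) (diff hg x)]
  simp; ring

lemma D_add (hf : ContDiff ℝ ∞ f) (hg : ContDiff ℝ ∞ g) (i : Fin n) :
    D i (fun x => f x + g x) = fun x => D i f x + D i g x := by
  funext x
  unfold D
  rw [fderiv_fun_add (diff hf x) (diff hg x)]
  simp

lemma D_const_mul (hf : ContDiff ℝ ∞ f) (c : ℝ) (i : Fin n) :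
    D i (fun x => c * f x) = fun x => c * D i f x := by
  funext x
  unfold D
  rw [fderiv_const_mul (diff hf x)]
  simp

lemma D_sum {ι : Type*} (s : Finset ι) {f : ι → EuclideanSpace ℝ (Fin n) → ℝ}
    (hf : ∀ j, ContDiff ℝ ∞ (f j)) (i : Fin n) :
    D i (fun x => ∑ j ∈ s, f j x) = fun x => ∑ j ∈ s, D i (f j) x := by
  funext x
  unfold D
  rw [fderiv_fun_sum (fun j _ => diff (hf j) x)]
  simp

lemma D_pow (hf : ContDiff ℝ ∞ f) (k : ℕ) (i : Fin n) :
    D i (fun x => f x ^ k) = fun x => k * f x ^ (k - 1) * D i f x := by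
  funext x
  unfold D
  rw [fderiv_fun_pow _ (diff hf x)]
  simp

lemma D_rpow (hf : ContDiff ℝ ∞ f) (h0 : ∀ x, 0 < f x) (m : ℝ) (i : Fin n) :
    D i (fun x => f x ^ m) = fun x => m * f x ^ (m - 1) * D i f x := by
  funext x
  unfold D
  rw [((diff hf x).hasFDerivAt.rpow_const (Or.inl (h0 x).ne')).fderiv]
  simp

lemma rpow_smooth (hf : ContDiff ℝ ∞ f) (h0 : ∀ x, 0 < f x) (m : ℝ) :
    ContDiff ℝ ∞ (fun x => f x ^ m) := hf.rpow_const_of_ne (fun x => (h0 x).ne')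

lemma DD_eq (hf : ContDiff ℝ ∞ f) (i j : Fin n) (x) :
    D i (D j f) x = fderiv ℝ (fderiv ℝ f) x (EuclideanSpace.single i 1)
      (EuclideanSpace.single j 1) := by
  have h : ContDiff ℝ ∞ (fderiv ℝ f) := hf.fderiv_right (m := ∞) (by simp)
  have h1 : HasFDerivAt (fun y => fderiv ℝ f y (EuclideanSpace.single j 1)) _ x :=
    (((h.differentiable (by simp)) x).hasFDerivAt).clm_apply
      (hasFDerivAt_const (EuclideanSpace.single j (1:ℝ)) x)
  unfold D
  rw [h1.fderiv]
  simp

lemma D_comm (hf : ContDiff ℝ ∞ f) (i j : Fin n) : D i (D j f) = D j (D i f) := by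
  funext x
  rw [DD_eq hf, DD_eq hf]
  exact (hf.contDiffAt.isSymmSndFDerivAt (by simp; exact WithTop.coe_le_coe.2 le_top)) _ _

lemma lap_eq (hf : ContDiff ℝ ∞ f) (x) : euclideanLaplacian f x = ∑ i, D i (D i f) x := by
  unfold euclideanLaplacian
  refine Finset.sum_congr rfl fun i _ => ?_
  rw [iteratedFDeriv_two_apply, DD_eq hf]
  rfl

/-- squared gradient -/
noncomputable def G (u : EuclideanSpace ℝ (Fin n) → ℝ) (x : EuclideanSpace ℝ (Fin n)) : ℝ :=
  ∑ j, D j u x ^ 2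

lemma G_smooth (hu : ContDiff ℝ ∞ u) : ContDiff ℝ ∞ (G u) := by
  unfold G
  exact ContDiff.sum fun j _ => (D_smooth hu j).pow 2

lemma G_nonneg (x) : 0 ≤ G u x := Finset.sum_nonneg fun _ _ => sq_nonneg _

lemma D_G (hu : ContDiff ℝ ∞ u) (i : Fin n) :
    D i (G u) = fun x => ∑ j, 2 * (D j u x * D i (D j u) x) := by
  unfold G
  rw [D_sum _ (fun j => (D_smooth hu j).pow 2)]
  funext x
  refine Finset.sum_congr rfl fun j _ => ?_
  rw [D_pow (D_smooth hu j)]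
  simp; ring

lemma DD_G (hu : ContDiff ℝ ∞ u) (i : Fin n) (x) :
    D i (D i (G u)) x = ∑ j, 2 * (D i (D j u) x ^ 2 + D j u x * D i (D i (D j u)) x) := by
  have h1 := fun j => D_smooth hu j
  have h2 := fun j => D_smooth (h1 j) i
  rw [D_G hu, D_sum _ (fun j => contDiff_const.mul ((h1 j).mul (h2 j)))]
  refine Finset.sum_congr rfl fun j _ => ?_
  rw [D_const_mul ((h1 j).mul (h2 j)), D_mul (h1 j) (h2 j)]
  ring

lemma DD_mul (hf : ContDiff ℝ ∞ f) (hg : ContDiff ℝ ∞ g) (i : Fin n) (x) :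
    D i (D i (fun x => f x * g x)) x
      = D i (D i f) x * g x + 2 * (D i f x * D i g x) + f x * D i (D i g) x := by
  rw [D_mul hf hg, D_add ((D_smooth hf i).mul hg) (hf.mul (D_smooth hg i)),
    D_mul (D_smooth hf i) hg, D_mul hf (D_smooth hg i)]
  ring

lemma DD_rpow (hf : ContDiff ℝ ∞ f) (h0 : ∀ x, 0 < f x) (m : ℝ) (i : Fin n) (x) :
    D i (D i (fun x => f x ^ m)) x
      = m * ((m - 1) * f x ^ (m - 2) * D i f x ^ 2 + f x ^ (m - 1) * D i (D i f) x) := by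
  rw [D_rpow hf h0, D_mul (contDiff_const.mul (rpow_smooth hf h0 _)) (D_smooth hf i),
    D_const_mul (rpow_smooth hf h0 _), D_rpow hf h0]
  rw [show m - 1 - 1 = m - 2 by ring]
  ring

/-- The function whose Laplacian we take. -/
noncomputable def P (m : ℝ) (u : EuclideanSpace ℝ (Fin n) → ℝ)
    (x : EuclideanSpace ℝ (Fin n)) : ℝ := u x ^ m * G u x

lemma P_smooth (hu : ContDiff ℝ ∞ u) (h0 : ∀ x, 0 < u x) (m : ℝ) : ContDiff ℝ ∞ (P m u) :=
  (rpow_smooth hu h0 m).mul (G_smooth hu)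

/-- The vector field. -/
noncomputable def W (m p A B : ℝ) (u : EuclideanSpace ℝ (Fin n) → ℝ) (i : Fin n)
    (x : EuclideanSpace ℝ (Fin n)) : ℝ :=
  (A * (u x ^ (m - 1) * G u x) + B * u x ^ (m + p)) * D i u x

lemma W_smooth (hu : ContDiff ℝ ∞ u) (h0 : ∀ x, 0 < u x) (m p A B : ℝ) (i : Fin n) :
    ContDiff ℝ ∞ (W m p A B u i) :=
  ((contDiff_const.mul ((rpow_smooth hu h0 _).mul (G_smooth hu))).add
    (contDiff_const.mul (rpow_smooth hu h0 _))).mul (D_smooth hu i)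

lemma lap_P (hu : ContDiff ℝ ∞ u) (h0 : ∀ x, 0 < u x) (m p : ℝ)
    (heq : ∀ x, ∑ i, D i (D i u) x = - u x ^ p) (x) :
    ∑ i, D i (D i (P m u)) x =
      m * ((m - 1) * u x ^ (m - 2) * G u x - u x ^ (m - 1) * u x ^ p) * G u x
      + 4 * m * u x ^ (m - 1) * (∑ i, ∑ j, D i u x * D j u x * D i (D j u) x)
      + 2 * u x ^ m * (∑ i, ∑ j, D i (D j u) x ^ 2)
      - 2 * p * u x ^ m * u x ^ (p - 1) * G u x := by
  have third : ∀ j, ∑ i, D i (D i (D j u)) x = - (p * u x ^ (p - 1) * D j u x) := by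
    intro j
    have e1 : ∀ i, D i (D i (D j u)) = D j (D i (D i u)) := fun i => by
      rw [D_comm hu i j, D_comm (D_smooth hu i) i j]
    have e2 := D_sum Finset.univ (fun i => D_smooth (D_smooth hu i) i) j
    have e3 : (fun x => ∑ i, D i (D i u) x) = fun x => (-1) * u x ^ p := by
      funext y; rw [heq y]; ring
    rw [e3, D_const_mul (rpow_smooth hu h0 p), D_rpow hu h0] at e2
    have e4 := congrFun e2 x
    simp only at e4
    simp only [e1]
    rw [← e4]; ring
  have key : ∀ i, D i (D i (P m u)) x =
      m * ((m - 1) * u x ^ (m - 2) * G u x) * (D i u x ^ 2) +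
      m * u x ^ (m - 1) * G u x * D i (D i u) x
      + 4 * m * u x ^ (m - 1) * (∑ j, D i u x * D j u x * D i (D j u) x)
      + 2 * u x ^ m * (∑ j, D i (D j u) x ^ 2)
      + 2 * u x ^ m * (∑ j, D j u x * D i (D i (D j u)) x) := by
    intro i
    have := DD_mul (rpow_smooth hu h0 m) (G_smooth hu) i x
    rw [DD_rpow hu h0, D_rpow hu h0, DD_G hu, D_G hu] at this
    unfold P
    rw [this]
    simp only [mul_add, Finset.sum_add_distrib, Finset.mul_sum]
    have : ∀ a b c d e a' b' c' d' e' : ℝ, a = a' → b = b' → c = c' → d = d' → e = e' →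
      a + b + c + (d + e) = a' + b' + c' + d' + e' := by
        intros; subst_vars; ring
    rw [add_mul]
    apply this
    · ring
    · ring
    · refine Finset.sum_congr rfl fun j _ => ?_
      ring
    · refine Finset.sum_congr rfl fun j _ => ?_
      ring
    · refine Finset.sum_congr rfl fun j _ => ?_
      ring
  simp only [key, Finset.sum_add_distrib, ← Finset.mul_sum]
  rw [heq x, show ∑ i, D i u x ^ 2 = G u x from rfl]
  rw [Finset.sum_comm (f := fun i j => D j u x * D i (D i (D j u)) x)]
  simp only [← Finset.mul_sum, third]
  have : ∑ j, D j u x * -(p * u x ^ (p - 1) * D j u x) = - (p * u x ^ (p - 1)) * G u x := by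
    unfold G
    rw [Finset.mul_sum]
    refine Finset.sum_congr rfl fun j _ => ?_
    ring
  rw [this]
  ring

lemma div_W (hu : ContDiff ℝ ∞ u) (h0 : ∀ x, 0 < u x) (m p A B : ℝ)
    (heq : ∀ x, ∑ i, D i (D i u) x = - u x ^ p) (x) :
    ∑ i, D i (W m p A B u i) x =
      - (A * (u x ^ (m - 1) * G u x) + B * u x ^ (m + p)) * u x ^ p
      + A * (m - 1) * u x ^ (m - 2) * G u x ^ 2
      + 2 * A * u x ^ (m - 1) * (∑ i, ∑ j, D i u x * D j u x * D i (D j u) x)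
      + B * (m + p) * u x ^ (m + p - 1) * G u x := by
  have key : ∀ i, D i (W m p A B u i) x =
      (A * (u x ^ (m - 1) * G u x) + B * u x ^ (m + p)) * D i (D i u) x
      + A * (m - 1) * u x ^ (m - 2) * G u x * D i u x ^ 2
      + 2 * A * u x ^ (m - 1) * (∑ j, D i u x * D j u x * D i (D j u) x)
      + B * (m + p) * u x ^ (m + p - 1) * D i u x ^ 2 := by
    intro i
    have s1 := rpow_smooth hu h0 (m - 1)
    have s2 := rpow_smooth hu h0 (m + p)
    have s3 := G_smooth hu
    unfold W
    rw [D_mul ((contDiff_const.mul (s1.mul s3)).add (contDiff_const.mul s2)) (D_smooth hu i),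
      D_add (contDiff_const.mul (s1.mul s3)) (contDiff_const.mul s2), D_const_mul (s1.mul s3),
      D_const_mul s2, D_mul s1 s3, D_rpow hu h0, D_rpow hu h0, D_G hu]
    rw [show m - 1 - 1 = m - 2 by ring]
    have : ∑ j, D i u x * D j u x * D i (D j u) x
        = D i u x * ∑ j, D j u x * D i (D j u) x := by
      rw [Finset.mul_sum]
      refine Finset.sum_congr rfl fun j _ => ?_
      ring
    rw [this]
    simp only [← Finset.mul_sum]
    ring
  simp only [key, Finset.sum_add_distrib, ← Finset.mul_sum]
  rw [heq x, show ∑ i, D i u x ^ 2 = G u x from rfl]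
  ring

lemma trace_ineq (hn : 0 < n) (h : Fin n → Fin n → ℝ) (v : Fin n → ℝ) (a : ℝ) :
    (∑ i, h i i + a * ∑ i, v i ^ 2) ^ 2 / n - a ^ 2 * (∑ i, v i ^ 2) ^ 2 ≤
      (∑ i, ∑ j, h i j ^ 2) + 2 * a * ∑ i, ∑ j, v i * v j * h i j := by
  have hn' : (0:ℝ) < n := by exact_mod_cast hn
  have h1 : (∑ i, (h i i + a * v i ^ 2)) ^ 2 ≤ n * ∑ i, (h i i + a * v i ^ 2) ^ 2 := by
    simpa using sq_sum_le_card_mul_sum_sq (s := Finset.univ) (f := fun i => h i i + a * v i ^ 2)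
  have h2 : ∑ i, (h i i + a * v i ^ 2) ^ 2 ≤ ∑ i, ∑ j, (h i j + a * (v i * v j)) ^ 2 := by
    refine Finset.sum_le_sum fun i _ => ?_
    have := Finset.single_le_sum (f := fun j => (h i j + a * (v i * v j)) ^ 2)
      (fun j _ => sq_nonneg _) (Finset.mem_univ i)
    simpa [sq] using this
  have h3 : ∑ i, ∑ j, (h i j + a * (v i * v j)) ^ 2 =
      (∑ i, ∑ j, h i j ^ 2) + 2 * a * (∑ i, ∑ j, v i * v j * h i j)
        + a ^ 2 * (∑ i, v i ^ 2) ^ 2 := by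
    rw [sq (∑ i, v i ^ 2), Finset.sum_mul_sum]
    simp only [Finset.mul_sum, ← Finset.sum_add_distrib]
    refine Finset.sum_congr rfl fun i _ => Finset.sum_congr rfl fun j _ => ?_
    ring
  rw [Finset.sum_add_distrib, ← Finset.mul_sum] at h1
  have : (∑ i, h i i + a * ∑ i, v i ^ 2) ^ 2 / n ≤ ∑ i, ∑ j, (h i j + a * (v i * v j)) ^ 2 := by
    rw [div_le_iff₀ hn']
    nlinarith
  linarith

/-- The basic pointwise differential inequality. -/
lemma pointwise (hn : 0 < n) (hu : ContDiff ℝ ∞ u) (h0 : ∀ x, 0 < u x) (m p A B c : ℝ)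
    (heq : ∀ x, ∑ i, D i (D i u) x = - u x ^ p)
    (c1 : c ≤ m * (m - 1) / 2 + A * (m - 1) - (m + A) ^ 2 * (n - 1) / n)
    (c2 : 0 ≤ -p - m / 2 - A + B * (m + p) - 2 * (m + A) / n)
    (c3 : c ≤ 1 / n - B) (x) :
    c * (u x ^ (m - 2) * G u x ^ 2 + u x ^ (m + 2 * p)) ≤
      1 / 2 * ∑ i, D i (D i (P m u)) x + ∑ i, D i (W m p A B u i) x := by
  rw [lap_P hu h0 m p heq, div_W hu h0 m p A B heq]
  have hy := h0 x
  have hn' : (0:ℝ) < n := by exact_mod_cast hn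
  have T := trace_ineq hn (fun i j => D i (D j u) x) (fun i => D i u x) ((m + A) / u x)
  rw [heq x, show ∑ i, D i u x ^ 2 = G u x from rfl] at T
  have hG : 0 ≤ G u x := G_nonneg x
  generalize G u x = g at *
  generalize (∑ i, ∑ j, D i u x * D j u x * D i (D j u) x) = Q at *
  generalize (∑ i, ∑ j, D i (D j u) x ^ 2) = S at *
  generalize u x = y at *
  have e1 : y ^ (m - 1) = y ^ m / y := by rw [Real.rpow_sub_one hy.ne']
  have e2 : y ^ (m - 2) = y ^ m / y ^ 2 := by
    rw [Real.rpow_sub hy]; norm_cast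
  have e3 : y ^ (p - 1) = y ^ p / y := by rw [Real.rpow_sub_one hy.ne']
  have e4 : y ^ (m + p) = y ^ m * y ^ p := by rw [Real.rpow_add hy]
  have e5 : y ^ (m + p - 1) = y ^ m * y ^ p / y := by rw [Real.rpow_sub_one hy.ne', e4]
  have e6 : y ^ (m + 2 * p) = y ^ m * (y ^ p) ^ 2 := by
    rw [Real.rpow_add hy, mul_comm 2 p, Real.rpow_mul hy.le]; norm_cast
  rw [e1, e2, e3, e4, e5, e6]
  have hm : 0 < y ^ m := Real.rpow_pos_of_pos hy m
  have hp : 0 < y ^ p := Real.rpow_pos_of_pos hy p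
  generalize y ^ m = M at *
  generalize y ^ p = F at *
  have k1 : 0 ≤ (m * (m - 1) / 2 + A * (m - 1) - (m + A) ^ 2 * (n - 1) / n - c) * (g / y) ^ 2 :=
    mul_nonneg (by linarith) (sq_nonneg _)
  have k2 : 0 ≤ (-p - m / 2 - A + B * (m + p) - 2 * (m + A) / n) * (g / y * F) :=
    mul_nonneg c2 (by positivity)
  have k3 : 0 ≤ (1 / n - B - c) * F ^ 2 := mul_nonneg (by linarith) (sq_nonneg _)
  have T' := mul_nonneg hm.le (add_nonneg (add_nonneg (add_nonneg (sub_nonneg.2 T) k1) k2) k3)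
  refine le_of_sub_nonneg (le_of_le_of_eq T' ?_)
  field_simp
  ring

lemma cut_pow {ψ : EuclideanSpace ℝ (Fin n) → ℝ} (k : ℕ) (hk : 1 ≤ k) {M R : ℝ} (hM : 0 ≤ M)
    (hR : 0 < R) (hs : ContDiff ℝ ∞ ψ) (n0 : ∀ x, 0 ≤ ψ x) (n1 : ∀ x, ψ x ≤ 1)
    (d1 : ∀ i x, |D i ψ x| ≤ M / R) (d2 : ∀ i x, |D i (D i ψ) x| ≤ M / R ^ 2) :
    (∀ i x, |D i (fun y => ψ y ^ (4 * k)) x| ≤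
      16 * k ^ 2 * (M ^ 2 + M) * (ψ x ^ (4 * k - 1) / R)) ∧
    (∀ i x, |D i (D i (fun y => ψ y ^ (4 * k))) x| ≤
      16 * k ^ 2 * (M ^ 2 + M) * (ψ x ^ (4 * k - 2) / R ^ 2)) := by
  have hkr : (1:ℝ) ≤ k := by exact_mod_cast hk
  have hq : (0:ℝ) ≤ 4 * k - 1 := by linarith
  constructor
  · intro i x
    rw [D_pow hs, abs_mul, abs_mul, abs_of_nonneg (pow_nonneg (n0 x) _), Nat.abs_cast]
    push_cast
    have hz := pow_nonneg (n0 x) (4 * k - 1)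
    generalize ψ x ^ (4 * k - 1) = z at *
    calc 4 * k * z * |D i ψ x| ≤ 4 * k * z * (M / R) := by
          have := d1 i x
          gcongr
      _ = 4 * k * M * (z / R) := by ring
      _ ≤ _ := by
          apply mul_le_mul_of_nonneg_right _ (by positivity)
          nlinarith [mul_nonneg (sq_nonneg (k:ℝ)) (sq_nonneg M),
            mul_nonneg (mul_nonneg (by linarith : (0:ℝ) ≤ k) hM) (sub_nonneg.2 hkr),
            mul_nonneg (by linarith : (0:ℝ) ≤ k) hM]
  · intro i x
    have hc : ((4 * k - 1 : ℕ) : ℝ) = 4 * k - 1 := by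
      rw [Nat.cast_sub (by omega)]; push_cast; ring
    have e : D i (D i (fun y => ψ y ^ (4 * k))) x =
        4 * k * ((4 * k - 1) * ψ x ^ (4 * k - 2) * D i ψ x ^ 2
          + ψ x ^ (4 * k - 1) * D i (D i ψ) x) := by
      rw [D_pow hs, D_mul (contDiff_const.mul (hs.pow _)) (D_smooth hs i),
        D_const_mul (hs.pow _), D_pow hs, hc, show 4 * k - 1 - 1 = 4 * k - 2 by omega]
      push_cast
      ring
    have hz := pow_nonneg (n0 x) (4 * k - 2)
    have hz1 : ψ x ^ (4 * k - 1) = ψ x ^ (4 * k - 2) * ψ x := by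
      rw [← pow_succ]; congr 1; omega
    rw [e, hz1]
    generalize ψ x ^ (4 * k - 2) = z at *
    have a1 : D i ψ x ^ 2 ≤ (M / R) ^ 2 := by
      rw [← sq_abs]
      have := d1 i x
      gcongr
    rw [abs_mul, abs_of_nonneg (by positivity : (0:ℝ) ≤ 4 * k)]
    have t0 := n0 x
    have t1 := n1 x
    calc 4 * (k:ℝ) * |(4 * k - 1) * z * D i ψ x ^ 2 + z * ψ x * D i (D i ψ) x|
        ≤ 4 * k * ((4 * k - 1) * z * (M / R) ^ 2 + z * 1 * (M / R ^ 2)) := by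
          have := d2 i x
          refine mul_le_mul_of_nonneg_left ((abs_add_le _ _).trans ?_) (by positivity)
          rw [abs_of_nonneg (by positivity : 0 ≤ (4 * k - 1) * z * D i ψ x ^ 2), abs_mul (z * ψ x),
            abs_of_nonneg (by positivity : 0 ≤ z * ψ x)]
          gcongr
      _ = 4 * k * ((4 * k - 1) * M ^ 2 + M) * (z / R ^ 2) := by field_simp
      _ ≤ _ := by
          apply mul_le_mul_of_nonneg_right _ (by positivity)
          nlinarith [mul_nonneg (sq_nonneg (k:ℝ)) (sq_nonneg M),
            mul_nonneg (by linarith : (0:ℝ) ≤ k) (sq_nonneg M),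
            mul_nonneg (mul_nonneg (by linarith : (0:ℝ) ≤ k) hM) (sub_nonneg.2 hkr),
            mul_nonneg (by linarith : (0:ℝ) ≤ k) hM]

lemma params (n : ℕ) (hn : 2 < n) (p : ℝ) (hp1 : 1 < p)
    (hp2 : p < ((n : ℝ) + 2) / ((n : ℝ) - 2)) : ∃ m A B c : ℝ, 0 < c ∧
    c ≤ m * (m - 1) / 2 + A * (m - 1) - (m + A) ^ 2 * (n - 1) / n ∧
    0 ≤ -p - m / 2 - A + B * (m + p) - 2 * (m + A) / n ∧
    c ≤ 1 / n - B ∧ 0 < m + 2 ∧ n < 2 * (m + 2 * p) / (p - 1) := by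
  have hN : (3:ℝ) ≤ n := by exact_mod_cast hn
  generalize (n:ℝ) = N at *
  have h1 : 0 < N - 1 := by linarith
  have h2 : 0 < N - 2 := by linarith
  have h3 : 0 < N + 2 := by linarith
  rw [lt_div_iff₀ h2] at hp2
  obtain ⟨s, hs1, hs2⟩ : ∃ s, p * (N - 1) / (N + 2) < s ∧ s < (N - 1) / (N - 2) := by
    apply exists_between
    rw [div_lt_div_iff₀ h3 h2]
    nlinarith
  rw [div_lt_iff₀ h3] at hs1
  rw [lt_div_iff₀ h2] at hs2
  have hs : 0 < s := by
    by_contra! h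
    nlinarith [mul_pos (by linarith : 0 < p) h1]
  set m := -2 * s / (N - 1) with hm
  set q := - s * N / (N - 1) with hq
  have hmq : q = m / 2 - s := by rw [hm, hq]; field_simp; ring
  have mlow : -2 < m * (N - 2) := by
    rw [hm, div_mul_eq_mul_div, lt_div_iff₀ h1]; nlinarith
  have hm0 : m < 0 := by rw [hm]; apply div_neg_of_neg_of_pos <;> linarith
  have al : m * (m - 1) / 2 + (q - m) * (m - 1) - (m + (q - m)) ^ 2 * (N - 1) / N
      = s * (1 - s * (N - 2) / (N - 1)) := by
    rw [hm, hq]; field_simp; ring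
  have alpos : 0 < s * (1 - s * (N - 2) / (N - 1)) := by
    apply mul_pos hs
    rw [sub_pos, div_lt_one h1]; exact hs2
  set d := ((N + 2) * s - (N - 1) * p) / N with hd
  have dpos : 0 < d := by apply div_pos <;> linarith
  set e := d / (|m + p| + 1) with he
  have epos : 0 < e := by positivity
  refine ⟨m, q - m, 1 / N - e, min (s * (1 - s * (N - 2) / (N - 1))) e, lt_min alpos epos, ?_, ?_,
    ?_, ?_, ?_⟩
  · rw [al]; exact min_le_left _ _
  · have : -p - m / 2 - (q - m) + (1 / N - e) * (m + p) - 2 * (m + (q - m)) / N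
        = d - e * (m + p) := by
      rw [hmq, hd]; field_simp; ring
    rw [this]
    have h5 : e * (|m + p| + 1) = d := by rw [he]; field_simp
    nlinarith [le_abs_self (m + p)]
  · have : 1 / N - (1 / N - e) = e := by ring
    rw [this]; exact min_le_right _ _
  · nlinarith
  · rw [lt_div_iff₀ (by linarith)]
    have : N * (p - 1) * (N - 2) < 2 * (m + 2 * p) * (N - 2) := by
      by_cases h : N ≤ 4
      · nlinarith
      · push Not at h
        nlinarith
    exact lt_of_mul_lt_mul_right this h2.le

lemma absorb (c K : ℝ) (hc : 0 < c) : ∃ C, 0 ≤ C ∧ ∀ X Y Z : ℝ,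
    K * (X ^ 2 * Z ^ 2 + X ^ 3 * Z + X * Y * Z) ≤ c / 2 * X ^ 4 + c / 4 * Y ^ 2 + C * Z ^ 4 := by
  refine ⟨2 * (K + K ^ 2 / c + 2 * K ^ 2 / c) ^ 2 / c, by positivity, fun X Y Z => ?_⟩
  set L := K + K ^ 2 / c + 2 * K ^ 2 / c with hL
  have a1 : K * (X * Y * Z) ≤ c / 4 * Y ^ 2 + K ^ 2 / c * (X ^ 2 * Z ^ 2) := by
    have : c / 4 * Y ^ 2 + K ^ 2 / c * (X ^ 2 * Z ^ 2) - K * (X * Y * Z)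
      = c / 4 * (Y - 2 * K / c * (X * Z)) ^ 2 := by field_simp; ring
    have : 0 ≤ c / 4 * (Y - 2 * K / c * (X * Z)) ^ 2 := by positivity
    linarith
  have a2 : K * (X ^ 3 * Z) ≤ c / 8 * X ^ 4 + 2 * K ^ 2 / c * (X ^ 2 * Z ^ 2) := by
    have : c / 8 * X ^ 4 + 2 * K ^ 2 / c * (X ^ 2 * Z ^ 2) - K * (X ^ 3 * Z)
      = c / 8 * (X ^ 2 - 4 * K / c * (X * Z)) ^ 2 := by field_simp; ring
    have : 0 ≤ c / 8 * (X ^ 2 - 4 * K / c * (X * Z)) ^ 2 := by positivity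
    linarith
  have a3 : L * (X ^ 2 * Z ^ 2) ≤ c / 8 * X ^ 4 + 2 * L ^ 2 / c * Z ^ 4 := by
    have : c / 8 * X ^ 4 + 2 * L ^ 2 / c * Z ^ 4 - L * (X ^ 2 * Z ^ 2)
      = c / 8 * (X ^ 2 - 4 * L / c * Z ^ 2) ^ 2 := by field_simp; ring
    have : 0 ≤ c / 8 * (X ^ 2 - 4 * L / c * Z ^ 2) ^ 2 := by positivity
    linarith
  have a4 : 0 ≤ c * X ^ 4 := by positivity
  rw [hL] at a3 ⊢
  nlinarith

lemma young (θ δ C : ℝ) (h0 : 0 < θ) (h1 : θ < 1) (hδ : 0 < δ) (hC : 0 ≤ C) : ∃ C', 0 ≤ C' ∧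
    ∀ a R : ℝ, 0 ≤ a → 0 < R → C * (a ^ θ / R ^ 4) ≤ δ * a + C' * R ^ (-(4 / (1 - θ))) := by
  have h2 : 0 < 1 - θ := by linarith
  refine ⟨(C * δ ^ (-θ)) ^ (1 / (1 - θ)), by positivity, fun a R ha hR => ?_⟩
  have key := Real.geom_mean_le_arith_mean2_weighted h0.le h2.le (p₁ := δ * a)
    (p₂ := (C * δ ^ (-θ)) ^ (1 / (1 - θ)) * R ^ (-(4 / (1 - θ)))) (by positivity) (by positivity)
    (by ring)
  have e1 : (δ * a) ^ θ *
      ((C * δ ^ (-θ)) ^ (1 / (1 - θ)) * R ^ (-(4 / (1 - θ)))) ^ (1 - θ) = C * (a ^ θ / R ^ 4) := by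
    rw [Real.mul_rpow hδ.le ha, Real.mul_rpow (by positivity) (by positivity),
      ← Real.rpow_mul (by positivity), ← Real.rpow_mul (by positivity)]
    have x1 : 1 / (1 - θ) * (1 - θ) = 1 := by field_simp
    have x2 : -(4 / (1 - θ)) * (1 - θ) = -((4:ℕ):ℝ) := by field_simp; norm_num
    rw [x1, x2, Real.rpow_one, Real.rpow_neg hR.le, Real.rpow_natCast, Real.rpow_neg hδ.le]
    have : 0 < δ ^ θ := by positivity
    field_simp
  rw [e1] at key
  refine key.trans ?_
  have b1 : 0 ≤ δ * a := by positivity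
  have b2 : 0 ≤ (C * δ ^ (-θ)) ^ (1 / (1 - θ)) * R ^ (-(4 / (1 - θ))) := by positivity
  nlinarith

lemma D_scale (hf : ContDiff ℝ ∞ f) (c : ℝ) (i : Fin n) :
    D i (fun x => f (c • x)) = fun x => c * D i f (c • x) := by
  funext x
  unfold D
  have h : HasFDerivAt (fun x => f (c • x)) _ x :=
    (diff hf (c • x)).hasFDerivAt.comp x ((hasFDerivAt_id x).const_smul c)
  rw [h.fderiv]
  simp

lemma D_cpt (hf : HasCompactSupport f) (i : Fin n) : HasCompactSupport (D i f) :=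
  hf.fderiv_apply ℝ _

lemma cutoff (n k : ℕ) (hk : 1 ≤ k) : ∃ K : ℝ, 0 ≤ K ∧ ∀ R : ℝ, 1 ≤ R →
    ∃ ψ : EuclideanSpace ℝ (Fin n) → ℝ, ContDiff ℝ ∞ ψ ∧ HasCompactSupport ψ ∧
      (∀ x, 0 ≤ ψ x) ∧ (∀ x, ψ x ≤ 1) ∧ (∀ x ∈ ball 0 1, ψ x = 1) ∧
      (∀ x, x ∉ ball 0 (2 * R) → ψ x = 0) ∧
      (∀ i x, |D i (fun y => ψ y ^ (4 * k)) x| ≤ K * (ψ x ^ (4 * k - 1) / R)) ∧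
      (∀ i x, |D i (D i (fun y => ψ y ^ (4 * k))) x| ≤ K * (ψ x ^ (4 * k - 2) / R ^ 2)) := by
  let η : ContDiffBump (0 : EuclideanSpace ℝ (Fin n)) := ⟨1, 2, by norm_num, by norm_num⟩
  have hη : ContDiff ℝ ∞ η := η.contDiff
  have hc : HasCompactSupport η := η.hasCompactSupport
  have b1 : ∀ i, ∃ C, ∀ x, ‖D i η x‖ ≤ C := fun i =>
    (D_smooth hη i).continuous.bounded_above_of_compact_support (D_cpt hc i)
  have b2 : ∀ i, ∃ C, ∀ x, ‖D i (D i η) x‖ ≤ C := fun i =>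
    (D_smooth (D_smooth hη i) i).continuous.bounded_above_of_compact_support (D_cpt (D_cpt hc i) i)
  choose C1 hC1 using b1
  choose C2 hC2 using b2
  have hC1' : ∀ i, 0 ≤ C1 i := fun i => (norm_nonneg _).trans (hC1 i 0)
  have hC2' : ∀ i, 0 ≤ C2 i := fun i => (norm_nonneg _).trans (hC2 i 0)
  set M := ∑ i, C1 i + ∑ i, C2 i with hM
  have hM0 : 0 ≤ M := add_nonneg (Finset.sum_nonneg fun i _ => hC1' i)
    (Finset.sum_nonneg fun i _ => hC2' i)
  have m1 : ∀ i x, |D i η x| ≤ M := fun i x => by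
    have := Finset.single_le_sum (f := C1) (fun j _ => hC1' j) (Finset.mem_univ i)
    have h2 := Finset.sum_nonneg (s := Finset.univ) (fun i _ => hC2' i)
    have h3 := hC1 i x
    rw [Real.norm_eq_abs] at h3
    linarith
  have m2 : ∀ i x, |D i (D i η) x| ≤ M := fun i x => by
    have := Finset.single_le_sum (f := C2) (fun j _ => hC2' j) (Finset.mem_univ i)
    have h2 := Finset.sum_nonneg (s := Finset.univ) (fun i _ => hC1' i)
    have h3 := hC2 i x
    rw [Real.norm_eq_abs] at h3
    linarith
  clear_value M
  have hkr : (1:ℝ) ≤ k := by exact_mod_cast hk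
  refine ⟨16 * k ^ 2 * (M ^ 2 + M), by positivity, fun R hR => ?_⟩
  have hR0 : 0 < R := by linarith
  have hs : ContDiff ℝ ∞ (fun x => η (R⁻¹ • x)) := hη.comp (contDiff_const_smul _)
  have d1 : ∀ i x, |D i (fun x => η (R⁻¹ • x)) x| ≤ M / R := fun i x => by
    rw [D_scale hη, abs_mul, abs_of_pos (inv_pos.2 hR0), inv_mul_eq_div]
    have := m1 i (R⁻¹ • x)
    gcongr
  have d2 : ∀ i x, |D i (D i (fun x => η (R⁻¹ • x))) x| ≤ M / R ^ 2 := fun i x => by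
    have hs' : ContDiff ℝ ∞ (fun x => D i η (R⁻¹ • x)) :=
      (D_smooth hη i).comp (contDiff_const_smul _)
    rw [D_scale hη, D_const_mul hs', D_scale (D_smooth hη i), abs_mul, abs_mul,
      abs_of_pos (inv_pos.2 hR0), ← mul_assoc, ← sq, inv_pow, inv_mul_eq_div]
    have := m2 i (R⁻¹ • x)
    gcongr
  have hcs : HasCompactSupport (fun x => η (R⁻¹ • x)) :=
    hc.comp_smul (inv_ne_zero hR0.ne')
  refine ⟨fun x => η (R⁻¹ • x), hs, hcs, fun x => η.nonneg, fun x => η.le_one, ?_, ?_, ?_, ?_⟩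
  · intro x hx
    apply η.one_of_mem_closedBall
    rw [mem_closedBall_zero_iff, norm_smul, norm_inv, Real.norm_eq_abs, abs_of_pos hR0]
    rw [mem_ball_zero_iff] at hx
    change R⁻¹ * ‖x‖ ≤ 1
    rw [inv_mul_le_iff₀ hR0]; linarith
  · intro x hx
    apply η.zero_of_le_dist
    rw [dist_zero_right, norm_smul, norm_inv, Real.norm_eq_abs, abs_of_pos hR0]
    rw [mem_ball_zero_iff] at hx
    change 2 ≤ R⁻¹ * ‖x‖
    rw [le_inv_mul_iff₀ hR0]; linarith
  · exact (cut_pow k hk hM0 hR0 hs (fun x => η.nonneg) (fun x => η.le_one) d1 d2).1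
  · exact (cut_pow k hk hM0 hR0 hs (fun x => η.nonneg) (fun x => η.le_one) d1 d2).2

set_option maxHeartbeats 2000000 in
/-- Pointwise absorption of the error terms. -/
lemma error_bound (m p A B c : ℝ) (hc : 0 < c) (hp1 : 1 < p) (hm : 0 < m + 2)
    (k : ℕ) (hk : 1 ≤ k) (hk2 : 1 ≤ k * (1 - (m + 2) / (m + 2 * p))) (K : ℝ) (hK : 0 ≤ K) :
    ∃ C, 0 ≤ C ∧ ∀ (y g s t R : ℝ) (v φ1 φ2 : Fin n → ℝ), 0 < y → g = ∑ i, v i ^ 2 →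
      0 ≤ s → s ≤ 1 → 0 < R → t = s ^ (4 * k) →
      (∀ i, |φ1 i| ≤ K * (s ^ (4 * k - 1) / R)) → (∀ i, |φ2 i| ≤ K * (s ^ (4 * k - 2) / R ^ 2)) →
      1 / 2 * ∑ i, y ^ m * g * φ2 i
        - ∑ i, (A * (y ^ (m - 1) * g) + B * y ^ (m + p)) * v i * φ1 i
      ≤ c * (t * (y ^ (m - 2) * g ^ 2 + y ^ (m + 2 * p))) - c / 2 * (t * y ^ (m + 2 * p))
        + C * R ^ (-(2 * (m + 2 * p) / (p - 1))) := by
  set θ := (m + 2) / (m + 2 * p) with hθ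
  have hmp : 0 < m + 2 * p := by linarith
  have θ0 : 0 < θ := by positivity
  have θ1 : θ < 1 := by rw [hθ, div_lt_one hmp]; linarith
  have hσ : 4 / (1 - θ) = 2 * (m + 2 * p) / (p - 1) := by
    have h1 : 1 - θ = 2 * (p - 1) / (m + 2 * p) := by rw [hθ]; field_simp; ring
    have h2 : p - 1 ≠ 0 := by linarith
    rw [h1]; field_simp; ring
  obtain ⟨C1, hC1, H1⟩ := absorb c (n * K * (1 + |A| + |B|)) hc
  obtain ⟨C2, hC2, H2⟩ := young θ (c / 4) C1 θ0 θ1 (by positivity) hC1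
  refine ⟨C2, hC2, ?_⟩
  intro y g s t R v φ1 φ2 hy hg s0 s1 hR ht b1 b2
  have hg0 : 0 ≤ g := by rw [hg]; exact Finset.sum_nonneg fun _ _ => sq_nonneg _
  set w := √g with hw
  have w0 : 0 ≤ w := Real.sqrt_nonneg _
  have hgw : g = w ^ 2 := (Real.sq_sqrt hg0).symm
  have hv : ∀ i, |v i| ≤ w := fun i => by
    apply Real.abs_le_sqrt
    rw [hg]
    exact Finset.single_le_sum (f := fun i => v i ^ 2) (fun j _ => sq_nonneg _) (Finset.mem_univ i)
  set a := y ^ ((m - 2) / 4) with ha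
  set b := y ^ ((m + 2 * p) / 2) with hb
  set z := y ^ ((m + 2) / 4) with hz
  have a0 : 0 < a := Real.rpow_pos_of_pos hy _
  have b0 : 0 < b := Real.rpow_pos_of_pos hy _
  have z0 : 0 < z := Real.rpow_pos_of_pos hy _
  have e1 : y ^ m = a ^ 2 * z ^ 2 := by
    rw [ha, hz, ← Real.rpow_natCast, ← Real.rpow_natCast, ← Real.rpow_mul hy.le,
      ← Real.rpow_mul hy.le, ← Real.rpow_add hy]
    congr 1; push_cast; ring
  have e2 : y ^ (m - 1) = a ^ 3 * z := by
    rw [ha, hz, ← Real.rpow_natCast, ← Real.rpow_mul hy.le, ← Real.rpow_add hy]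
    congr 1; push_cast; ring
  have e3 : y ^ (m + p) = a * b * z := by
    rw [ha, hb, hz, ← Real.rpow_add hy, ← Real.rpow_add hy]
    congr 1; ring
  have e4 : y ^ (m - 2) = a ^ 4 := by
    rw [ha, ← Real.rpow_natCast, ← Real.rpow_mul hy.le]
    congr 1; push_cast; ring
  have e5 : y ^ (m + 2 * p) = b ^ 2 := by
    rw [hb, ← Real.rpow_natCast, ← Real.rpow_mul hy.le]
    congr 1; push_cast; ring
  obtain ⟨l, rfl⟩ : ∃ l, k = l + 1 := ⟨k - 1, by omega⟩
  set X := s ^ (l + 1) * a * w with hX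
  set Y := s ^ (2 * (l + 1)) * b with hY
  set Z := z * s ^ l / R with hZ
  have f1 : y ^ m * g * (s ^ (4 * (l + 1) - 2) / R ^ 2) = X ^ 2 * Z ^ 2 := by
    rw [e1, hgw, hX, hZ, show 4 * (l + 1) - 2 = (l + 1) * 2 + l * 2 by omega, pow_add, pow_mul,
      pow_mul]
    ring
  have f2 : y ^ (m - 1) * g * w * (s ^ (4 * (l + 1) - 1) / R) = X ^ 3 * Z := by
    rw [e2, hgw, hX, hZ, show 4 * (l + 1) - 1 = (l + 1) * 3 + l by omega, pow_add, pow_mul]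
    ring
  have f3 : y ^ (m + p) * w * (s ^ (4 * (l + 1) - 1) / R) = X * Y * Z := by
    rw [e3, hX, hY, hZ, show 4 * (l + 1) - 1 = (l + 1) + (2 * (l + 1)) + l by omega, pow_add,
      pow_add]
    ring
  have f4 : t * (y ^ (m - 2) * g ^ 2) = X ^ 4 := by
    rw [ht, e4, hgw, hX, show 4 * (l + 1) = (l + 1) * 4 by omega, pow_mul]; ring
  have f5 : t * y ^ (m + 2 * p) = Y ^ 2 := by
    rw [ht, e5, hY, show 4 * (l + 1) = (2 * (l + 1)) * 2 by omega, pow_mul]; ring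
  have f6 : Z ^ 4 ≤ (Y ^ 2) ^ θ / R ^ 4 := by
    rw [← f5, hZ, div_pow, ht]
    apply div_le_div_of_nonneg_right _ (by positivity)
    rw [Real.mul_rpow (by positivity) (by positivity), ← Real.rpow_mul hy.le,
      ← Real.rpow_natCast s (4 * (l + 1)), ← Real.rpow_mul s0, mul_pow, ← pow_mul]
    have g1 : y ^ ((m + 2 * p) * θ) = z ^ 4 := by
      rw [hz, ← Real.rpow_natCast, ← Real.rpow_mul hy.le, hθ]
      congr 1; push_cast; field_simp
    rw [g1, mul_comm]
    apply mul_le_mul_of_nonneg_right _ (by positivity)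
    rw [← Real.rpow_natCast]
    apply Real.rpow_le_rpow_of_exponent_ge' s0 s1 (by positivity)
    push_cast at hk2 ⊢
    nlinarith
  have Xn : 0 ≤ X := by positivity
  have Yn : 0 ≤ Y := by positivity
  have Zn : 0 ≤ Z := by positivity
  clear_value X Y Z a b z w
  have T1 : 1 / 2 * ∑ i, y ^ m * g * φ2 i ≤ n * K * (X ^ 2 * Z ^ 2) := by
    have hh : 0 ≤ y ^ m * g := by positivity
    have : ∑ i, y ^ m * g * φ2 i ≤ ∑ _i : Fin n, K * (X ^ 2 * Z ^ 2) := by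
      refine Finset.sum_le_sum fun i _ => ?_
      calc y ^ m * g * φ2 i ≤ y ^ m * g * (K * (s ^ (4 * (l + 1) - 2) / R ^ 2)) :=
            mul_le_mul_of_nonneg_left ((le_abs_self _).trans (b2 i)) hh
        _ = _ := by rw [← f1]; ring
    rw [Finset.sum_const, Finset.card_univ, Fintype.card_fin, nsmul_eq_mul] at this
    have h5 : 0 ≤ n * K * (X ^ 2 * Z ^ 2) := by positivity
    linarith
  have T2 : - ∑ i, (A * (y ^ (m - 1) * g) + B * y ^ (m + p)) * v i * φ1 i
      ≤ n * K * (|A| * (X ^ 3 * Z) + |B| * (X * Y * Z)) := by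
    rw [← Finset.sum_neg_distrib]
    have : ∑ i, -((A * (y ^ (m - 1) * g) + B * y ^ (m + p)) * v i * φ1 i)
        ≤ ∑ _i : Fin n, K * (|A| * (X ^ 3 * Z) + |B| * (X * Y * Z)) := by
      refine Finset.sum_le_sum fun i _ => ?_
      refine (neg_le_abs _).trans ?_
      rw [abs_mul, abs_mul]
      have q1 : |A * (y ^ (m - 1) * g) + B * y ^ (m + p)| ≤
          |A| * (y ^ (m - 1) * g) + |B| * y ^ (m + p) := by
        refine (abs_add_le _ _).trans ?_
        rw [abs_mul A, abs_mul B, abs_of_nonneg (by positivity : 0 ≤ y ^ (m - 1) * g),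
          abs_of_nonneg (by positivity : 0 ≤ y ^ (m + p))]
      calc _ ≤ (|A| * (y ^ (m - 1) * g) + |B| * y ^ (m + p)) * w
            * (K * (s ^ (4 * (l + 1) - 1) / R)) := by
              have := hv i
              have := b1 i
              gcongr
        _ = _ := by rw [← f2, ← f3]; ring
    rw [Finset.sum_const, Finset.card_univ, Fintype.card_fin, nsmul_eq_mul] at this
    linarith
  have T3 := H1 X Y Z
  have T4 := H2 (Y ^ 2) R (by positivity) hR
  have T5 := mul_le_mul_of_nonneg_left f6 hC1
  rw [hσ] at T4
  have T6 : n * K * (X ^ 2 * Z ^ 2) + n * K * (|A| * (X ^ 3 * Z) + |B| * (X * Y * Z))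
      ≤ n * K * (1 + |A| + |B|) * (X ^ 2 * Z ^ 2 + X ^ 3 * Z + X * Y * Z) := by
    have r : 0 ≤ n * K * ((|A| + |B|) * (X ^ 2 * Z ^ 2) + (1 + |B|) * (X ^ 3 * Z)
      + (1 + |A|) * (X * Y * Z)) := by positivity
    linarith
  rw [mul_add t, f4, f5]
  have T7 : 0 ≤ c * X ^ 4 := by positivity
  linarith

lemma ibp {φ : EuclideanSpace ℝ (Fin n) → ℝ} (hφ : ContDiff ℝ ∞ φ) (hc : HasCompactSupport φ)
    (hf : ContDiff ℝ ∞ f) (i : Fin n) :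
    ∫ x, φ x * D i f x = - ∫ x, D i φ x * f x := by
  apply integral_mul_fderiv_eq_neg_fderiv_mul_of_integrable
  · exact ((D_smooth hφ i).continuous.mul hf.continuous).integrable_of_hasCompactSupport
      ((D_cpt hc i).mul_right)
  · exact (hφ.continuous.mul (D_smooth hf i).continuous).integrable_of_hasCompactSupport
      (hc.mul_right)
  · exact (hφ.continuous.mul hf.continuous).integrable_of_hasCompactSupport (hc.mul_right)
  · exact fun x _ => diff hφ x
  · exact fun x _ => diff hf x

lemma ibp2 {φ : EuclideanSpace ℝ (Fin n) → ℝ} (hφ : ContDiff ℝ ∞ φ) (hc : HasCompactSupport φ)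
    (hf : ContDiff ℝ ∞ f) (i : Fin n) :
    ∫ x, φ x * D i (D i f) x = ∫ x, D i (D i φ) x * f x := by
  rw [ibp hφ hc (D_smooth hf i), ibp (D_smooth hφ i) (D_cpt hc i) hf, neg_neg]

lemma int_mul {φ : EuclideanSpace ℝ (Fin n) → ℝ} (hφ : ContDiff ℝ ∞ φ) (hc : HasCompactSupport φ)
    (hf : ContDiff ℝ ∞ f) : Integrable (fun x => φ x * f x) :=
  (hφ.continuous.mul hf.continuous).integrable_of_hasCompactSupport (hc.mul_right)

lemma ibp_total {φ : EuclideanSpace ℝ (Fin n) → ℝ} (hφ : ContDiff ℝ ∞ φ)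
    (hc : HasCompactSupport φ) {Q : EuclideanSpace ℝ (Fin n) → ℝ} (hQ : ContDiff ℝ ∞ Q)
    {V : Fin n → EuclideanSpace ℝ (Fin n) → ℝ} (hV : ∀ i, ContDiff ℝ ∞ (V i)) :
    ∫ x, φ x * (1 / 2 * ∑ i, D i (D i Q) x + ∑ i, D i (V i) x) =
      ∫ x, (1 / 2 * ∑ i, Q x * D i (D i φ) x - ∑ i, V i x * D i φ x) := by
  have l : ∀ x, φ x * (1 / 2 * ∑ i, D i (D i Q) x + ∑ i, D i (V i) x)
      = 1 / 2 * (∑ i, φ x * D i (D i Q) x) + ∑ i, φ x * D i (V i) x := fun x => by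
    rw [← Finset.mul_sum, ← Finset.mul_sum]; ring
  have r : ∀ x, (1 / 2 * ∑ i, Q x * D i (D i φ) x - ∑ i, V i x * D i φ x)
      = 1 / 2 * (∑ i, D i (D i φ) x * Q x) - ∑ i, D i φ x * V i x := fun x => by
    simp only [mul_comm]
  simp only [l, r]
  have i1 : ∀ i, Integrable (fun x => φ x * D i (D i Q) x) := fun i =>
    int_mul hφ hc (D_smooth (D_smooth hQ i) i)
  have i2 : ∀ i, Integrable (fun x => φ x * D i (V i) x) := fun i =>
    int_mul hφ hc (D_smooth (hV i) i)
  have i3 : ∀ i, Integrable (fun x => D i (D i φ) x * Q x) := fun i =>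
    int_mul (D_smooth (D_smooth hφ i) i) (D_cpt (D_cpt hc i) i) hQ
  have i4 : ∀ i, Integrable (fun x => D i φ x * V i x) := fun i =>
    int_mul (D_smooth hφ i) (D_cpt hc i) (hV i)
  rw [integral_add ((integrable_finsetSum _ fun i _ => i1 i).const_mul _)
    (integrable_finsetSum _ fun i _ => i2 i),
    integral_sub ((integrable_finsetSum _ fun i _ => i3 i).const_mul _)
    (integrable_finsetSum _ fun i _ => i4 i), integral_const_mul, integral_const_mul,
    integral_finsetSum _ (fun i _ => i1 i), integral_finsetSum _ (fun i _ => i2 i),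
    integral_finsetSum _ (fun i _ => i3 i), integral_finsetSum _ (fun i _ => i4 i)]
  simp only [ibp2 hφ hc hQ, ibp hφ hc (hV _), Finset.sum_neg_distrib]
  ring

theorem main (n : ℕ) (hn : 2 < n) (p : ℝ) (hp1 : 1 < p)
    (hp2 : p < ((n : ℝ) + 2) / ((n : ℝ) - 2))
    (u : EuclideanSpace ℝ (Fin n) → ℝ) (hu : ContDiff ℝ ∞ u) (h0 : ∀ x, 0 < u x)
    (heq : ∀ x, ∑ i, D i (D i u) x = - u x ^ p) : False := by
  obtain ⟨m, A, B, c, hc, c1, c2, c3, hm, hσ⟩ := params n hn p hp1 hp2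
  have hmp : 0 < m + 2 * p := by linarith
  have hθ : 0 < 1 - (m + 2) / (m + 2 * p) := by
    rw [sub_pos, div_lt_one hmp]; linarith
  obtain ⟨k, hk⟩ := exists_nat_ge (1 / (1 - (m + 2) / (m + 2 * p)))
  rw [div_le_iff₀ hθ] at hk
  have hk1 : 1 ≤ k := by
    by_contra! h
    obtain rfl : k = 0 := by omega
    norm_num at hk
  obtain ⟨K, hK, cut⟩ := cutoff n k hk1
  obtain ⟨C, hC, err⟩ := error_bound (n := n) m p A B c hc hp1 hm k hk1 hk K hK
  set σ := 2 * (m + 2 * p) / (p - 1) with hσd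
  set κ := ∫ x in ball (0 : EuclideanSpace ℝ (Fin n)) 1, u x ^ (m + 2 * p) with hκ
  have us := rpow_smooth hu h0 (m + 2 * p)
  have κpos : 0 < κ := by
    rw [hκ, setIntegral_pos_iff_support_of_nonneg_ae]
    · have : Function.support (fun x => u x ^ (m + 2 * p)) = Set.univ := by
        ext x; simp [(Real.rpow_pos_of_pos (h0 x) _).ne']
      rw [this, Set.univ_inter]
      exact measure_ball_pos _ _ one_pos
    · exact Filter.Eventually.of_forall fun x => (Real.rpow_pos_of_pos (h0 x) _).le
    · exact (us.continuous.continuousOn.integrableOn_compact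
        (isCompact_closedBall (0 : EuclideanSpace ℝ (Fin n)) 1)).mono_set ball_subset_closedBall
  set vb := (volume (ball (0 : EuclideanSpace ℝ (Fin n)) 1)).toReal with hvb
  have key : ∀ R : ℝ, 1 ≤ R → c / 2 * κ ≤ C * 2 ^ n * vb * R ^ (-(σ - n)) := by
    intro R hR
    have hR0 : 0 < R := by linarith
    obtain ⟨ψ, ψs, ψc, ψ0, ψ1, ψin, ψout, b1, b2⟩ := cut R hR
    set φ : EuclideanSpace ℝ (Fin n) → ℝ := fun y => ψ y ^ (4 * k) with hφ
    have φs : ContDiff ℝ ∞ φ := ψs.pow _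
    have φc : HasCompactSupport φ := by
      apply ψc.comp_left (g := fun t : ℝ => t ^ (4 * k))
      simp; omega
    have φ0 : ∀ x, 0 ≤ φ x := fun x => pow_nonneg (ψ0 x) _
    have tot := ibp_total φs φc (P_smooth hu h0 m) (fun i => W_smooth hu h0 m p A B i)
    have st : ContDiff ℝ ∞ (fun x => u x ^ (m - 2) * G u x ^ 2 + u x ^ (m + 2 * p)) :=
      ((rpow_smooth hu h0 _).mul ((G_smooth hu).pow 2)).add us
    have L1 : ∫ x, φ x * (c * (u x ^ (m - 2) * G u x ^ 2 + u x ^ (m + 2 * p))) ≤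
        ∫ x, φ x * (1 / 2 * ∑ i, D i (D i (P m u)) x + ∑ i, D i (W m p A B u i) x) := by
      apply integral_mono
      · exact int_mul φs φc (contDiff_const.mul st)
      · apply int_mul φs φc
        exact (contDiff_const.mul (ContDiff.sum fun i _ =>
          D_smooth (D_smooth (P_smooth hu h0 m) i) i)).add
          (ContDiff.sum fun i _ => D_smooth (W_smooth hu h0 m p A B i) i)
      · intro x
        exact mul_le_mul_of_nonneg_left
          (pointwise (by omega) hu h0 m p A B c heq c1 c2 c3 x) (φ0 x)
    have I1 : Integrable (fun x => φ x * (c * (u x ^ (m - 2) * G u x ^ 2 + u x ^ (m + 2 * p)))) :=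
      int_mul φs φc (contDiff_const.mul st)
    have I2 : Integrable (fun x => c / 2 * (φ x * u x ^ (m + 2 * p))) :=
      (int_mul φs φc us).const_mul _
    have I3 : Integrable ((ball (0 : EuclideanSpace ℝ (Fin n)) (2 * R)).indicator
        (fun _ => C * R ^ (-σ))) :=
      (integrable_indicator_iff measurableSet_ball).2
        (integrableOn_const measure_ball_lt_top.ne)
    have L2 : ∫ x, (1 / 2 * ∑ i, P m u x * D i (D i φ) x - ∑ i, W m p A B u i x * D i φ x) ≤
        ∫ x, (φ x * (c * (u x ^ (m - 2) * G u x ^ 2 + u x ^ (m + 2 * p)))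
          - c / 2 * (φ x * u x ^ (m + 2 * p))
          + (ball (0 : EuclideanSpace ℝ (Fin n)) (2 * R)).indicator
              (fun _ => C * R ^ (-σ)) x) := by
      apply integral_mono
      · apply Integrable.sub
        · apply Integrable.const_mul
          refine integrable_finsetSum _ fun i _ => ?_
          simp only [mul_comm (P m u _)]
          exact int_mul (D_smooth (D_smooth φs i) i) (D_cpt (D_cpt φc i) i) (P_smooth hu h0 m)
        · refine integrable_finsetSum _ fun i _ => ?_
          simp only [mul_comm (W m p A B u i _)]
          exact int_mul (D_smooth φs i) (D_cpt φc i) (W_smooth hu h0 m p A B i)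
      · exact (I1.sub I2).add I3
      · intro x
        simp only
        by_cases hx : x ∈ ball (0 : EuclideanSpace ℝ (Fin n)) (2 * R)
        · rw [Set.indicator_of_mem hx]
          have := err (u x) (G u x) (ψ x) (φ x) R (fun i => D i u x) (fun i => D i φ x)
            (fun i => D i (D i φ) x) (h0 x) rfl (ψ0 x) (ψ1 x) hR0 rfl (fun i => b1 i x)
            (fun i => b2 i x)
          unfold P W
          linarith
        · rw [Set.indicator_of_notMem hx]
          have z := ψout x hx
          have z1 : ∀ i, D i φ x = 0 := fun i => by
            have := b1 i x
            rw [z, zero_pow (by omega)] at this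
            simpa using this
          have z2 : ∀ i, D i (D i φ) x = 0 := fun i => by
            have := b2 i x
            rw [z, zero_pow (by omega)] at this
            simpa using this
          have z3 : φ x = 0 := by
            rw [hφ]; simp only [z]; rw [zero_pow (by omega)]
          simp [z1, z2, z3]
    have I12 : Integrable (fun x => φ x * (c * (u x ^ (m - 2) * G u x ^ 2 + u x ^ (m + 2 * p)))
        - c / 2 * (φ x * u x ^ (m + 2 * p))) := I1.sub I2
    rw [integral_add I12 I3, integral_sub I1 I2, integral_indicator measurableSet_ball,
      setIntegral_const, integral_const_mul (c / 2)] at L2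
    have L3 : κ ≤ ∫ x, φ x * u x ^ (m + 2 * p) := by
      rw [hκ, ← integral_indicator measurableSet_ball]
      apply integral_mono
      · refine (integrable_indicator_iff measurableSet_ball).2 ?_
        exact (us.continuous.continuousOn.integrableOn_compact
          (isCompact_closedBall (0 : EuclideanSpace ℝ (Fin n)) 1)).mono_set ball_subset_closedBall
      · exact int_mul φs φc us
      · intro x
        simp only
        by_cases hx : x ∈ ball (0 : EuclideanSpace ℝ (Fin n)) 1
        · rw [Set.indicator_of_mem hx, hφ]
          simp [ψin x hx]
        · rw [Set.indicator_of_notMem hx]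
          exact mul_nonneg (φ0 x) (Real.rpow_pos_of_pos (h0 x) _).le
    have vol : volume.real (ball (0 : EuclideanSpace ℝ (Fin n)) (2 * R)) = (2 * R) ^ n * vb := by
      haveI : Nonempty (Fin n) := ⟨⟨0, by omega⟩⟩
      rw [measureReal_def, Measure.addHaar_ball _ _ (by positivity), ENNReal.toReal_mul,
        ENNReal.toReal_ofReal (by positivity), finrank_euclideanSpace_fin]
    rw [vol, smul_eq_mul] at L2
    have e : (2 * R) ^ n * vb * (C * R ^ (-σ)) = C * 2 ^ n * vb * R ^ (-(σ - n)) := by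
      rw [show -(σ - n) = -σ + n by ring, Real.rpow_add hR0, Real.rpow_natCast, mul_pow]
      ring
    rw [e] at L2
    have := mul_le_mul_of_nonneg_left L3 (by positivity : 0 ≤ c / 2)
    linarith
  have lim : Filter.Tendsto (fun R : ℝ => C * 2 ^ n * vb * R ^ (-(σ - n))) Filter.atTop (nhds 0) := by
    simpa using (tendsto_rpow_neg_atTop (by linarith : 0 < σ - n)).const_mul (C * 2 ^ n * vb)
  have := ge_of_tendsto lim (Filter.eventually_atTop.2 ⟨1, key⟩)
  have : 0 < c / 2 * κ := by positivity
  linarith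

end GS

theorem stmt_13 (n : ℕ) (hn : 2 < n) (p : ℝ) (hp1 : 1 < p)
    (hp2 : p < ((n : ℝ) + 2) / ((n : ℝ) - 2))
    (u : EuclideanSpace ℝ (Fin n) → ℝ) (hu : ContDiff ℝ (⊤ : ℕ∞) u) (hupos : ∀ x, 0 < u x)
    (heq : ∀ x, euclideanLaplacian u x + u x ^ p = 0) :
    False := by
  refine GS.main n hn p hp1 hp2 u hu hupos fun x => ?_
  rw [← GS.lap_eq hu]
  linarith [heq x]
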